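/- Let a and b be coprime odd integers with 1 < a < b, and let k = ab. Then there exist m ≥ 2 and an induced subgraph H of the torus C_k^2 with |V(H)| = a^m such that for every n ≥ 2 and every subgraph H' of C_k^n isomorphic to H, the vertex set of H' intersects each equivalence class of the relation x ∼ y (defined by x_i ≡ y_i mod a for all coordinates i) in a number of vertices divisible by a. -/

import Mathlib

/-- The torus `C_k^n`. -/
def torus (k n : ℕ) : SimpleGraph (Fin n → ZMod k) :=
  SimpleGraph.fromRel fun u v => ∃ i, u i - v i = 1 ∧ ∀ j, j ≠ i → u j = v j

/-- Adjacent vertices of the torus differ by a signed unit vector. -/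
lemma torus_adj_exists_single {k n : ℕ} {u v : Fin n → ZMod k} (h : (torus k n).Adj u v) :
    ∃ i : Fin n, ∃ s : ℤ, (s = 1 ∨ s = -1) ∧ v = u + Pi.single i (s : ZMod k) := by
  rw [torus, SimpleGraph.fromRel_adj] at h
  obtain ⟨-, ⟨i, hi, hj⟩ | ⟨i, hi, hj⟩⟩ := h
  · refine ⟨i, -1, Or.inr rfl, ?_⟩
    ext l
    by_cases hl : l = i
    · subst hl
      simp [← hi]
    · simp [hl, hj l hl]
  · refine ⟨i, 1, Or.inl rfl, ?_⟩
    ext l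
    by_cases hl : l = i
    · subst hl
      simp [← hi]
    · simp [hl, hj l hl]

lemma torus_adj_add_single {k n : ℕ} (hk : 1 < k) (u : Fin n → ZMod k) (i : Fin n) :
    (torus k n).Adj u (u + Pi.single i 1) := by
  have : Fact (1 < k) := ⟨hk⟩
  rw [torus, SimpleGraph.fromRel_adj]
  refine ⟨fun h => ?_, Or.inr ⟨i, by simp, fun j hj => by simp [hj]⟩⟩
  have := congrFun h i
  simp at this

/-- A closed walk of odd length `k` in the torus of side `k` runs once around a coordinate line. -/
lemma closed_walk_eq_coordinate_line {k n : ℕ} (hk : Odd k) (w : ℕ → Fin n → ZMod k)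
    (hw : ∀ t < k, (torus k n).Adj (w t) (w (t + 1))) (hclosed : w k = w 0) :
    ∃ i : Fin n, ∃ s : ℤ, (s = 1 ∨ s = -1) ∧
      ∀ t ≤ k, w t = w 0 + Pi.single i ((s : ZMod k) * t) := by
  have hstep : ∀ t, ∃ i : Fin n, ∃ s : ℤ, t < k →
      (s = 1 ∨ s = -1) ∧ w (t + 1) = w t + Pi.single i (s : ZMod k) := by
    intro t
    by_cases ht : t < k
    · obtain ⟨i, s, h⟩ := torus_adj_exists_single (hw t ht)
      exact ⟨i, s, fun _ => h⟩
    · obtain ⟨i, -⟩ := torus_adj_exists_single (hw 0 hk.pos)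
      exact ⟨i, 0, fun h => absurd h ht⟩
  choose d s hds using hstep
  have hpos : ∀ i, ∀ t ≤ k,
      w t i = w 0 i + ((∑ r ∈ Finset.range t, if d r = i then s r else 0 : ℤ) : ZMod k) := by
    intro i t
    induction t with
    | zero => simp
    | succ t ih =>
      intro ht
      rw [(hds t ht).2, Pi.add_apply, ih (by omega), Finset.sum_range_succ, Pi.single_apply]
      by_cases h : d t = i
      · simp [h, add_assoc]
      · simp [h, Ne.symm h]
  have hodd : Odd (∑ i, ∑ r ∈ Finset.range k, if d r = i then s r else 0) := by
    rw [Finset.sum_comm]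
    simp only [Finset.sum_ite_eq, Finset.mem_univ, if_true]
    have heven : Even (∑ t ∈ Finset.range k, (s t - 1)) := by
      refine Finset.even_sum _ fun t ht => ?_
      rcases (hds t (Finset.mem_range.1 ht)).1 with h | h <;> rw [h] <;> decide
    have := heven.add_odd ((Int.odd_coe_nat k).2 hk)
    simpa [Finset.sum_sub_distrib] using this
  obtain ⟨i, hi⟩ : ∃ i, Odd (∑ r ∈ Finset.range k, if d r = i then s r else 0) := by
    by_contra! h
    simp only [Int.not_odd_iff_even] at h
    exact Int.not_even_iff_odd.2 hodd (Finset.even_sum _ fun i _ => h i)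
  have hdvd : (k : ℤ) ∣ ∑ r ∈ Finset.range k, if d r = i then s r else 0 := by
    rw [← ZMod.intCast_zmod_eq_zero_iff_dvd _ k]
    have := hpos i k le_rfl
    rw [hclosed] at this
    simpa using this
  have hne : (∑ r ∈ Finset.range k, if d r = i then s r else 0) ≠ 0 := by
    intro h
    rw [h] at hi
    exact absurd hi (by decide)
  have habs := Int.le_of_dvd (abs_pos.2 hne) ((dvd_abs _ _).2 hdvd)
  have hconst : ∃ e : ℤ, (e = 1 ∨ e = -1) ∧
      ∀ r ∈ Finset.range k, (if d r = i then s r else 0) = e := by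
    have hbound : ∀ r ∈ Finset.range k, -1 ≤ (if d r = i then s r else 0) ∧
        (if d r = i then s r else 0) ≤ 1 := by
      intro r hr
      have := (hds r (Finset.mem_range.1 hr)).1
      split_ifs <;> omega
    rcases le_abs.1 habs with h | h
    · refine ⟨1, Or.inl rfl, (Finset.sum_eq_sum_iff_of_le fun r hr => (hbound r hr).2).1 ?_⟩
      refine le_antisymm (Finset.sum_le_sum fun r hr => (hbound r hr).2) ?_
      simpa using h
    · refine ⟨-1, Or.inr rfl, fun r hr => ((Finset.sum_eq_sum_iff_of_le
        fun r hr => (hbound r hr).1).1 ?_ r hr).symm⟩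
      refine le_antisymm (Finset.sum_le_sum fun r hr => (hbound r hr).1) ?_
      simp only [Finset.sum_const, Finset.card_range, nsmul_eq_mul]
      linarith
  obtain ⟨e, he, hconst⟩ := hconst
  refine ⟨i, e, he, fun t => ?_⟩
  induction t with
  | zero => simp
  | succ t ih =>
    intro ht
    have h := hconst t (Finset.mem_range.2 ht)
    have hd : d t = i := by
      by_contra hd
      rw [if_neg hd] at h
      omega
    rw [if_pos hd] at h
    rw [(hds t ht).2, ih (by omega), h, hd, add_assoc, ← Pi.single_add]
    push_cast
    ring_nf

/-- Two distinct coordinate steps from `p` have only one common neighbour besides `p`. -/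
lemma common_neighbor_eq_square_corner {k n : ℕ} {p q : Fin n → ZMod k} {i j : Fin n}
    (hij : i ≠ j) {x y : ZMod k} (hx : x ≠ 0) (hy : y ≠ 0)
    (h₁ : (torus k n).Adj (p + Pi.single i x) q) (h₂ : (torus k n).Adj (p + Pi.single j y) q)
    (hpq : q ≠ p) : q = p + Pi.single i x + Pi.single j y := by
  obtain ⟨i', s, -, hs⟩ := torus_adj_exists_single h₁
  obtain ⟨j', t, -, ht⟩ := torus_adj_exists_single h₂
  have key : ∀ l, (Pi.single i x : Fin n → ZMod k) l + (Pi.single i' (s : ZMod k) : Fin n → ZMod k) l =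
      (Pi.single j y : Fin n → ZMod k) l + (Pi.single j' (t : ZMod k) : Fin n → ZMod k) l := by
    intro l
    have := congrFun (hs.symm.trans ht) l
    simp only [Pi.add_apply, add_assoc] at this
    exact add_left_cancel this
  by_cases hj' : j' = i
  · subst hj'
    have h := key j'
    rw [ht, add_right_comm]
    congr 2
    by_cases hi' : i' = j'
    · subst hi'
      have := key j
      simp [hij.symm] at this
      exact absurd this.symm hy
    · simp [hij, Ne.symm hi'] at h
      rw [h]
  · have h := key i
    have h' : x + (Pi.single i' (s : ZMod k) : Fin n → ZMod k) i = 0 := by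
      simpa [hij, Ne.symm hj'] using h
    by_cases hi' : i' = i
    · subst hi'
      refine absurd ?_ hpq
      rw [hs, add_assoc, ← Pi.single_add]
      simp at h'
      simp [h']
    · simp [Ne.symm hi'] at h'
      exact absurd h' hx

/-- An injective homomorphism to a torus of odd side from a lower set containing both full axes
is the restriction of an axis-parallel embedding. -/
lemma eq_axis_parallel_of_lowerSet {k n : ℕ} (hk : Odd k) (hk' : 1 < k)
    (T : Set (ℕ × ℕ)) (hT : IsLowerSet T) (F : ℕ × ℕ → Fin n → ZMod k) (hinj : Set.InjOn F T)
    (hrow : (k - 1, 0) ∈ T) (hcol : (0, k - 1) ∈ T)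
    (hF₁ : ∀ x y, (x + 1, y) ∈ T → (torus k n).Adj (F (x, y)) (F (x + 1, y)))
    (hF₂ : ∀ x y, (x, y + 1) ∈ T → (torus k n).Adj (F (x, y)) (F (x, y + 1)))
    (hrow' : (torus k n).Adj (F (k - 1, 0)) (F (k, 0))) (hrow₀ : F (k, 0) = F (0, 0))
    (hcol' : (torus k n).Adj (F (0, k - 1)) (F (0, k))) (hcol₀ : F (0, k) = F (0, 0))
    (hTk : ∀ p ∈ T, p.1 < k ∧ p.2 < k) :
    ∃ i j : Fin n, i ≠ j ∧ ∃ s t : ℤ, (s = 1 ∨ s = -1) ∧ (t = 1 ∨ t = -1) ∧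
      ∀ p ∈ T, F p = F (0, 0) + Pi.single i ((s : ZMod k) * p.1) +
        Pi.single j ((t : ZMod k) * p.2) := by
  have : Fact (1 < k) := ⟨hk'⟩
  have mem_row : ∀ x < k, (x, 0) ∈ T := fun x hx =>
    hT (Prod.mk_le_mk.2 ⟨by omega, le_rfl⟩) hrow
  have mem_col : ∀ y < k, (0, y) ∈ T := fun y hy =>
    hT (Prod.mk_le_mk.2 ⟨le_rfl, by omega⟩) hcol
  obtain ⟨i, s, hs, hi⟩ := closed_walk_eq_coordinate_line hk (fun x => F (x, 0)) (by
    intro x hx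
    by_cases h : x + 1 < k
    · exact hF₁ x 0 (mem_row _ h)
    · obtain rfl : k = x + 1 := by omega
      exact hrow') hrow₀
  obtain ⟨j, t, ht, hj⟩ := closed_walk_eq_coordinate_line hk (fun y => F (0, y)) (by
    intro y hy
    by_cases h : y + 1 < k
    · exact hF₂ 0 y (mem_col _ h)
    · obtain rfl : k = y + 1 := by omega
      exact hcol') hcol₀
  have unit_ne : ∀ e : ℤ, (e = 1 ∨ e = -1) → (e : ZMod k) ≠ 0 := by
    rintro e (rfl | rfl) <;> simp
  have hij : i ≠ j := by
    rintro rfl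
    have h₁ := hj 1 hk'.le
    by_cases hst : s = t
    · have h₂ := hi 1 hk'.le
      rw [hst] at h₂
      have := hinj (mem_row 1 hk') (mem_col 1 hk') (h₂.trans h₁.symm)
      simp at this
    · have h₂ := hi (k - 1) (by omega)
      have hts : (t : ZMod k) = -s := by
        rw [show t = -s by omega]
        push_cast
        rfl
      have hc : ((k - 1 : ℕ) : ZMod k) = -1 := by
        rw [Nat.cast_sub hk'.le]
        simp
      rw [hc] at h₂
      rw [hts] at h₁
      have := hinj (mem_row (k - 1) (by omega)) (mem_col 1 hk') (h₂.trans (by simp [h₁]))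
      simp at this
  refine ⟨i, j, hij, s, t, hs, ht, ?_⟩
  rintro ⟨x, y⟩ hxy
  induction x generalizing y with
  | zero => simpa using hj y (hTk _ hxy).2.le
  | succ x ihx =>
    induction y with
    | zero => simpa using hi (x + 1) (hTk _ hxy).1.le
    | succ y ihy =>
      have m₁ : (x + 1, y) ∈ T := hT (Prod.mk_le_mk.2 ⟨le_rfl, by omega⟩) hxy
      have m₂ : (x, y + 1) ∈ T := hT (Prod.mk_le_mk.2 ⟨by omega, le_rfl⟩) hxy
      have m₀ : (x, y) ∈ T := hT (Prod.mk_le_mk.2 ⟨by omega, le_rfl⟩) m₁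
      have e₁ : F (x + 1, y) = F (x, y) + Pi.single i (s : ZMod k) := by
        rw [ihy m₁, ihx y m₀]
        push_cast
        simp only [mul_add, mul_one, Pi.single_add]
        abel
      have e₂ : F (x, y + 1) = F (x, y) + Pi.single j (t : ZMod k) := by
        rw [ihx _ m₂, ihx y m₀]
        push_cast
        simp only [mul_add, mul_one, Pi.single_add]
        abel
      have a₁ := hF₂ (x + 1) y hxy
      have a₂ := hF₁ x (y + 1) hxy
      rw [e₁] at a₁
      rw [e₂] at a₂
      rw [common_neighbor_eq_square_corner hij (unit_ne s hs) (unit_ne t ht) a₁ a₂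
        (fun h => by simpa using hinj hxy m₀ h), ← e₁, ihy m₁]
      push_cast
      simp only [mul_add, mul_one, Pi.single_add]
      abel

/-- A `b × b` square contains Young diagrams with full axes of every admissible size. -/
lemma exists_lowerSet_card (b c : ℕ) (hb : 0 < b) (hc : 2 * b - 1 ≤ c) (hcb : c ≤ b * b) :
    ∃ D : Finset (ℕ × ℕ), IsLowerSet (D : Set (ℕ × ℕ)) ∧ D ⊆ Finset.range b ×ˢ Finset.range b ∧
      (b - 1, 0) ∈ D ∧ (0, b - 1) ∈ D ∧ D.card = c := by
  induction c, hc using Nat.le_induction with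
  | base =>
    refine ⟨(Finset.range b ×ˢ {0}) ∪ ({0} ×ˢ Finset.range b), ?_, ?_, ?_, ?_, ?_⟩
    · rintro ⟨x, y⟩ ⟨x', y'⟩ h hx
      rw [Prod.mk_le_mk] at h
      simp only [Finset.coe_union, Set.mem_union, Finset.mem_coe, Finset.mem_product,
        Finset.mem_range, Finset.mem_singleton] at hx ⊢
      omega
    · rintro ⟨x, y⟩ hx
      simp only [Finset.mem_union, Finset.mem_product,
        Finset.mem_range, Finset.mem_singleton] at hx ⊢
      omega
    · simp [hb]
    · simp [hb]
    · have h := Finset.card_union_add_card_inter (Finset.range b ×ˢ ({0} : Finset ℕ))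
        (({0} : Finset ℕ) ×ˢ Finset.range b)
      have hi : (Finset.range b ×ˢ ({0} : Finset ℕ)) ∩ (({0} : Finset ℕ) ×ˢ Finset.range b) =
          {(0, 0)} := by
        ext ⟨x, y⟩
        simp only [Finset.mem_inter, Finset.mem_product, Finset.mem_range, Finset.mem_singleton,
          Prod.mk.injEq]
        omega
      rw [hi] at h
      simp only [Finset.card_product, Finset.card_range, Finset.card_singleton] at h
      omega
  | succ c hc ih =>
    obtain ⟨D, hlow, hsub, hr, hcl, hcard⟩ := ih (by omega)
    obtain ⟨p, hp, hmin⟩ : ∃ p, p ∈ (Finset.range b ×ˢ Finset.range b) \ D ∧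
        ∀ q ∈ (Finset.range b ×ˢ Finset.range b) \ D, q ≤ p → p ≤ q := by
      have hne : ((Finset.range b ×ˢ Finset.range b) \ D).Nonempty := by
        rw [← Finset.card_pos, Finset.card_sdiff_of_subset hsub]
        simp
        omega
      obtain ⟨p, hp⟩ := Finset.exists_minimal hne
      exact ⟨p, hp.1, fun q hq hqp => hp.2 hq hqp⟩
    rw [Finset.mem_sdiff] at hp
    refine ⟨insert p D, ?_, Finset.insert_subset hp.1 hsub, Finset.mem_insert_of_mem hr,
      Finset.mem_insert_of_mem hcl, by rw [Finset.card_insert_of_notMem hp.2, hcard]⟩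
    intro q r hrq hq
    rw [Finset.mem_coe, Finset.mem_insert] at hq ⊢
    rcases hq with rfl | hq
    · by_cases hrD : r ∈ D
      · exact Or.inr hrD
      · left
        refine le_antisymm hrq (hmin r (Finset.mem_sdiff.2 ⟨?_, hrD⟩) hrq)
        have := hp.1
        rw [Finset.mem_product, Finset.mem_range, Finset.mem_range] at this ⊢
        exact ⟨hrq.1.trans_lt this.1, hrq.2.trans_lt this.2⟩
    · exact Or.inr (hlow hrq hq)

/-- The blow-up of `D`: every cell is replaced by an `a × a` block of cells. -/
def blowUp (a : ℕ) (D : Finset (ℕ × ℕ)) : Finset (ℕ × ℕ) :=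
  (D ×ˢ (Finset.range a ×ˢ Finset.range a)).image
    fun q => (a * q.1.1 + q.2.1, a * q.1.2 + q.2.2)

lemma mem_blowUp {a : ℕ} (ha : 0 < a) {D : Finset (ℕ × ℕ)} {p : ℕ × ℕ} :
    p ∈ blowUp a D ↔ (p.1 / a, p.2 / a) ∈ D := by
  rw [blowUp, Finset.mem_image]
  constructor
  · rintro ⟨⟨⟨u, v⟩, r, s⟩, h, rfl⟩
    simp only [Finset.mem_product, Finset.mem_range] at h
    simpa [Nat.mul_add_div ha, Nat.div_eq_of_lt h.2.1, Nat.div_eq_of_lt h.2.2] using h.1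
  · intro h
    refine ⟨((p.1 / a, p.2 / a), p.1 % a, p.2 % a), ?_, ?_⟩
    · simp [h, Nat.mod_lt _ ha]
    · simp [Nat.div_add_mod]

lemma card_blowUp_filter_mod {a : ℕ} (D : Finset (ℕ × ℕ)) {r s : ℕ} (hr : r < a) (hs : s < a) :
    ((blowUp a D).filter fun p => p.1 % a = r ∧ p.2 % a = s).card = D.card := by
  have ha : 0 < a := by omega
  refine Finset.card_nbij' (fun p => (p.1 / a, p.2 / a)) (fun q => (a * q.1 + r, a * q.2 + s))
    ?_ ?_ ?_ ?_
  · intro p hp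
    simp only [Finset.coe_filter, Set.mem_ofPred_eq, mem_blowUp ha] at hp
    exact hp.1
  · intro q hq
    simp only [Finset.coe_filter, Set.mem_ofPred_eq, mem_blowUp ha]
    simpa [Nat.mul_add_div ha, Nat.div_eq_of_lt hr, Nat.div_eq_of_lt hs, Nat.mod_eq_of_lt hr,
      Nat.mod_eq_of_lt hs, Nat.mul_add_mod] using hq
  · rintro ⟨x, y⟩ hp
    simp only [Finset.coe_filter, Set.mem_ofPred_eq] at hp
    obtain ⟨-, rfl, rfl⟩ := hp
    simp [Nat.div_add_mod]
  · rintro ⟨u, v⟩ -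
    simp [Nat.mul_add_div ha, Nat.div_eq_of_lt hr, Nat.div_eq_of_lt hs]

lemma card_blowUp {a : ℕ} (ha : 0 < a) (D : Finset (ℕ × ℕ)) :
    (blowUp a D).card = a ^ 2 * D.card := by
  rw [Finset.card_eq_sum_card_fiberwise (f := fun p => (p.1 % a, p.2 % a))
    (t := Finset.range a ×ˢ Finset.range a)]
  · rw [Finset.sum_congr rfl (g := fun _ => D.card)]
    · simp [sq]
    · rintro ⟨r, s⟩ h
      simp only [Finset.mem_product, Finset.mem_range] at h
      simp only [Prod.mk.injEq]
      exact card_blowUp_filter_mod D h.1 h.2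
  · intro p _
    simp [Nat.mod_lt _ ha]

lemma exists_pow_mem_Icc {a b : ℕ} (ha : 3 ≤ a) (hab : a < b) :
    ∃ j, 2 * b - 1 ≤ a ^ j ∧ a ^ j ≤ b * b := by
  refine ⟨Nat.log a (b * b), ?_, Nat.pow_log_le_self a (by nlinarith)⟩
  have hlt := Nat.lt_pow_succ_log_self (b := a) (by omega) (b * b)
  rw [pow_succ] at hlt
  by_cases h : 2 * a ≤ b
  · by_contra! hcon
    have h₁ : a ^ Nat.log a (b * b) ≤ 2 * b := by omega
    nlinarith [Nat.mul_le_mul_right a h₁, Nat.mul_le_mul_right b h]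
  · have h₂ : 2 ≤ Nat.log a (b * b) := Nat.le_log_of_pow_le (by omega) (by nlinarith)
    have h₃ : a ^ 2 ≤ a ^ Nat.log a (b * b) := Nat.pow_le_pow_right (by omega) h₂
    have h₄ : 4 * a ≤ a ^ 2 + 3 := by nlinarith
    omega

lemma val_mod_eq_iff {a k : ℕ} [NeZero k] (h : a ∣ k) (x y : ZMod k) :
    x.val % a = y.val % a ↔ ZMod.castHom h (ZMod a) x = ZMod.castHom h (ZMod a) y := by
  rw [← Nat.ModEq, ← ZMod.natCast_eq_natCast_iff]
  simp [ZMod.natCast_val]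

/-- An axis-parallel copy of a blow-up meets each congruence class modulo `a` in either no vertex
or as many vertices as there are blocks. -/
lemma dvd_card_axis_parallel_filter {a k n : ℕ} [NeZero a] [NeZero k] (hak : a ∣ k)
    (D : Finset (ℕ × ℕ)) (hD : a ∣ D.card) (o y : Fin n → ZMod k) {i j : Fin n} (hij : i ≠ j)
    {s t : ℤ} (hs : s = 1 ∨ s = -1) (ht : t = 1 ∨ t = -1) (F : ℕ × ℕ → Fin n → ZMod k)
    (hF : ∀ p ∈ blowUp a D, F p = o + Pi.single i ((s : ZMod k) * p.1) +
      Pi.single j ((t : ZMod k) * p.2)) :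
    a ∣ ((blowUp a D).filter fun p => ∀ l, (F p l).val % a = (y l).val % a).card := by
  have unit_mul : ∀ e : ℤ, (e = 1 ∨ e = -1) → ∀ (u v : ZMod k) (x : ℕ),
      ((u + (e : ZMod k) * x).val % a = v.val % a ↔
        x % a = ((e : ZMod a) * ZMod.castHom hak (ZMod a) (v - u)).val) := by
    intro e he u v x
    rw [val_mod_eq_iff hak, ← ZMod.val_natCast, (ZMod.val_injective a).eq_iff]
    simp only [map_add, map_mul, map_sub, map_intCast, map_natCast]
    rcases he with rfl | rfl
    · push_cast
      constructor <;> intro h <;> linear_combination h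
    · push_cast
      constructor <;> intro h <;> linear_combination -h
  by_cases hy : ∀ l, l ≠ i → l ≠ j → (o l).val % a = (y l).val % a
  · rw [Finset.filter_congr (q := fun p =>
      p.1 % a = ((s : ZMod a) * ZMod.castHom hak (ZMod a) (y i - o i)).val ∧
      p.2 % a = ((t : ZMod a) * ZMod.castHom hak (ZMod a) (y j - o j)).val),
      card_blowUp_filter_mod D (ZMod.val_lt _) (ZMod.val_lt _)]
    · exact hD
    · intro p hp
      rw [← unit_mul s hs, ← unit_mul t ht, hF p hp]
      constructor
      · intro h
        have hi := h i
        have hj := h j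
        simp only [Pi.add_apply, Pi.single_eq_same, Pi.single_eq_of_ne hij,
          Pi.single_eq_of_ne hij.symm, add_zero] at hi hj
        exact ⟨hi, hj⟩
      · rintro ⟨hi, hj⟩ l
        by_cases hli : l = i
        · subst hli
          simpa only [Pi.add_apply, Pi.single_eq_same, Pi.single_eq_of_ne hij, add_zero] using hi
        · by_cases hlj : l = j
          · subst hlj
            simpa only [Pi.add_apply, Pi.single_eq_same, Pi.single_eq_of_ne hij.symm, add_zero]
              using hj
          · simpa only [Pi.add_apply, Pi.single_eq_of_ne hli, Pi.single_eq_of_ne hlj, add_zero]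
              using hy l hli hlj
  · push Not at hy
    obtain ⟨l, hli, hlj, hl⟩ := hy
    rw [Finset.filter_false_of_mem]
    · simp
    · intro p hp h
      have := h l
      rw [hF p hp] at this
      simp only [Pi.add_apply, Pi.single_eq_of_ne hli, Pi.single_eq_of_ne hlj, add_zero] at this
      exact hl this

theorem copies_meet_classes_in_multiples (a b : ℕ) (ha : 1 < a) (hab : a < b)
    (hodda : Odd a) (hoddb : Odd b) (hcop : Nat.Coprime a b) :
    ∃ m : ℕ, 2 ≤ m ∧ ∃ H : (torus (a * b) 2).Subgraph, H.IsInduced ∧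
      H.verts.ncard = a ^ m ∧
      ∀ n : ℕ, 2 ≤ n → ∀ H' : (torus (a * b) n).Subgraph,
        Nonempty (H.coe ≃g H'.coe) →
        ∀ y : Fin n → ZMod (a * b),
          a ∣ (H'.verts ∩ {x | ∀ i, (x i).val % a = (y i).val % a}).ncard := by
  have ha0 : 0 < a := by omega
  have hb0 : 0 < b := by omega
  have ha3 : 3 ≤ a := by
    obtain ⟨c, rfl⟩ := hodda
    omega
  obtain ⟨j, hj₁, hj₂⟩ := exists_pow_mem_Icc ha3 hab
  have hj0 : j ≠ 0 := by
    rintro rfl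
    simp at hj₁
    omega
  obtain ⟨D, hlow, hsub, hr, hc, hcard⟩ := exists_lowerSet_card b (a ^ j) hb0 hj₁ hj₂
  have hk : Odd (a * b) := hodda.mul hoddb
  have hk1 : 1 < a * b := by nlinarith
  have hak : a ∣ a * b := dvd_mul_right a b
  generalize hkdef : a * b = k at hk hk1 hak ⊢
  have : NeZero k := ⟨by omega⟩
  have : NeZero a := ⟨by omega⟩
  have hTk : ∀ p ∈ blowUp a D, p.1 < k ∧ p.2 < k := by
    intro p hp
    have := hsub ((mem_blowUp ha0).1 hp)
    simp only [Finset.mem_product, Finset.mem_range, Nat.div_lt_iff_lt_mul ha0] at this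
    rwa [← hkdef, mul_comm]
  have hTlow : IsLowerSet (blowUp a D : Set (ℕ × ℕ)) := by
    intro p q hqp hp
    rw [Finset.mem_coe, mem_blowUp ha0] at hp ⊢
    exact hlow (Prod.mk_le_mk.2 ⟨Nat.div_le_div_right hqp.1, Nat.div_le_div_right hqp.2⟩) hp
  have hdiv : (k - 1) / a = b - 1 := by
    rw [Nat.div_eq_iff ha0]
    obtain ⟨b, rfl⟩ : ∃ c, b = c + 1 := ⟨b - 1, by omega⟩
    rw [← hkdef, Nat.add_sub_cancel]
    have : a * (b + 1) = b * a + a := by ring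
    omega
  have hTrow : (k - 1, 0) ∈ blowUp a D := by simpa [mem_blowUp ha0, hdiv] using hr
  have hTcol : (0, k - 1) ∈ blowUp a D := by simpa [mem_blowUp ha0, hdiv] using hc
  let E : ℕ × ℕ → Fin 2 → ZMod k := fun p => ![(p.1 : ZMod k), (p.2 : ZMod k)]
  have hE : Set.InjOn E (blowUp a D) := by
    rintro p hp q hq h
    have h₁ := congrFun h 0
    have h₂ := congrFun h 1
    simp only [E, Matrix.cons_val_zero, Matrix.cons_val_one] at h₁ h₂
    rw [ZMod.natCast_eq_natCast_iff] at h₁ h₂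
    exact Prod.ext (h₁.eq_of_lt_of_lt (hTk p hp).1 (hTk q hq).1)
      (h₂.eq_of_lt_of_lt (hTk p hp).2 (hTk q hq).2)
  have hE₁ : ∀ x y, (torus k 2).Adj (E (x, y)) (E (x + 1, y)) := by
    intro x y
    convert torus_adj_add_single hk1 (E (x, y)) 0 using 1
    ext l
    fin_cases l <;> simp [E]
  have hE₂ : ∀ x y, (torus k 2).Adj (E (x, y)) (E (x, y + 1)) := by
    intro x y
    convert torus_adj_add_single hk1 (E (x, y)) 1 using 1
    ext l
    fin_cases l <;> simp [E]
  refine ⟨j + 2, by omega, (⊤ : (torus k 2).Subgraph).induce (E '' blowUp a D), ?_, ?_, ?_⟩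
  · intro u hu v hv h
    exact ⟨hu, hv, h⟩
  · rw [SimpleGraph.Subgraph.induce_verts, hE.ncard_image, Set.ncard_coe_finset,
      card_blowUp ha0, hcard]
    ring
  · rintro n - H' ⟨φ⟩ y
    classical
    let F : ℕ × ℕ → Fin n → ZMod k := fun p =>
      if h : E p ∈ E '' blowUp a D then (φ ⟨E p, h⟩ : Fin n → ZMod k) else 0
    have hFval : ∀ p (h : E p ∈ E '' blowUp a D), F p = φ ⟨E p, h⟩ := fun p h => dif_pos h
    have hmem : ∀ p ∈ blowUp a D, E p ∈ E '' blowUp a D := fun p hp => ⟨p, hp, rfl⟩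
    have hFinj : Set.InjOn F (blowUp a D) := by
      intro p hp q hq h
      rw [hFval p (hmem p hp), hFval q (hmem q hq)] at h
      exact hE hp hq (congrArg Subtype.val (φ.injective (Subtype.ext h)))
    have hFadj : ∀ p q, E p ∈ E '' blowUp a D → E q ∈ E '' blowUp a D →
        (torus k 2).Adj (E p) (E q) → (torus k n).Adj (F p) (F q) := by
      intro p q hp hq h
      rw [hFval p hp, hFval q hq]
      exact H'.adj_sub (φ.map_rel_iff.2 (show (SimpleGraph.Subgraph.coe _).Adj ⟨E p, hp⟩ ⟨E q, hq⟩
        from ⟨hp, hq, h⟩))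
    have hFimage : H'.verts = F '' blowUp a D := by
      ext v
      constructor
      · intro hv
        obtain ⟨⟨_, p, hp, rfl⟩, hu⟩ := φ.surjective ⟨v, hv⟩
        exact ⟨p, hp, by rw [hFval p (hmem p hp), hu]⟩
      · rintro ⟨p, hp, rfl⟩
        rw [hFval p (hmem p hp)]
        exact (φ _).2
    have hrow₀ : E (k, 0) = E (0, 0) := by simp [E]
    have hcol₀ : E (0, k) = E (0, 0) := by simp [E]
    have hzero : (0, 0) ∈ blowUp a D := hTlow (Prod.mk_le_mk.2 ⟨Nat.zero_le _, le_rfl⟩) hTrow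
    obtain ⟨i, l, hil, s, t, hs, ht, hF⟩ := eq_axis_parallel_of_lowerSet hk hk1 (blowUp a D) hTlow F
      hFinj hTrow hTcol
      (fun x y h => hFadj _ _
        (hmem _ (hTlow (Prod.mk_le_mk.2 ⟨Nat.le_succ x, le_rfl⟩) h)) (hmem _ h) (hE₁ x y))
      (fun x y h => hFadj _ _
        (hmem _ (hTlow (Prod.mk_le_mk.2 ⟨le_rfl, Nat.le_succ y⟩) h)) (hmem _ h) (hE₂ x y))
      (hFadj _ _ (hmem _ hTrow) (hrow₀ ▸ hmem _ hzero) (by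
        simpa only [Nat.sub_add_cancel hk1.le] using hE₁ (k - 1) 0))
      (by simp only [F, hrow₀])
      (hFadj _ _ (hmem _ hTcol) (hcol₀ ▸ hmem _ hzero) (by
        simpa only [Nat.sub_add_cancel hk1.le] using hE₂ 0 (k - 1)))
      (by simp only [F, hcol₀])
      hTk
    have hcount := dvd_card_axis_parallel_filter hak D (hcard ▸ dvd_pow_self a hj0) (F (0, 0)) y hil
      hs ht F hF
    have hset : H'.verts ∩ {x | ∀ i, (x i).val % a = (y i).val % a} =
        F '' ((blowUp a D).filter fun p => ∀ l, (F p l).val % a = (y l).val % a :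
          Finset (ℕ × ℕ)) := by
      rw [hFimage]
      ext v
      simp only [Set.mem_inter_iff, Set.mem_image, Set.mem_ofPred_eq, Finset.coe_filter,
        Finset.mem_coe]
      constructor
      · rintro ⟨⟨p, hp, rfl⟩, h⟩
        exact ⟨p, ⟨hp, h⟩, rfl⟩
      · rintro ⟨p, ⟨hp, h⟩, rfl⟩
        exact ⟨⟨p, hp, rfl⟩, h⟩
    rw [hset, (hFinj.mono (Finset.coe_subset.2 (Finset.filter_subset _ _))).ncard_image, Set.ncard_coe_finset]
    exact hcount
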